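/- arXiv:2204.11322 — 3 statements merged into one kernel-verified Lean document; each statement's English description precedes it below -/
import Mathlib

section
/- Let n ≥ 1 and let f : ℝⁿ → ℝ be twice continuously differentiable. Let U ⊆ ℝⁿ be an open convex set on which ∇f is Lipschitz with constant g_Lip > 0 and ∇²f is Lipschitz with constant H_Lip > 0. Let ξ₁ > 0, ξ₂ ∈ (0,1), σ_max > 0, and let x ∈ U, s ∈ ℝⁿ with x + s ∈ U, and λ ∈ [0, σ_max‖s‖]. Set r = ∇f(x) + (∇²f(x) + λI)s and suppose that either ‖r‖ ≤ ξ₁‖s‖² or ‖r‖ ≤ ξ₂ min{1, ‖s‖} ‖∇f(x)‖. Then (1 − ξ₂)‖∇f(x + s)‖ ≤ (½H_Lip + σ_max + max{ξ₁, ξ₂ g_Lip}) ‖s‖², and consequently ‖s‖ ≥ ((1 − ξ₂)/(½H_Lip + σ_max + max{ξ₁, ξ₂ g_Lip}))^{1/2} ‖∇f(x + s)‖^{1/2}. -/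
/-- First-order Taylor estimate on a convex set for a map whose derivative satisfies a Lipschitz
bound there. -/
theorem Convex.norm_image_add_sub_sub_fderiv_le {E F : Type*} [NormedAddCommGroup E]
    [NormedSpace ℝ E] [NormedAddCommGroup F] [NormedSpace ℝ F] {G : E → F}
    (hG : Differentiable ℝ G) {U : Set E} (hU : Convex ℝ U) {L : ℝ}
    (hL : ∀ y ∈ U, ∀ z ∈ U, ‖fderiv ℝ G y - fderiv ℝ G z‖ ≤ L * ‖y - z‖)
    {x s : E} (hx : x ∈ U) (hxs : x + s ∈ U) :
    ‖G (x + s) - G x - fderiv ℝ G x s‖ ≤ 1 / 2 * L * ‖s‖ ^ 2 := by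
  have hderiv (t : ℝ) : HasDerivAt (fun t : ℝ => G (x + t • s) - G x - t • fderiv ℝ G x s)
      ((fderiv ℝ G (x + t • s) - fderiv ℝ G x) s) t := by
    have hline : HasDerivAt (fun t : ℝ => x + t • s) s t := by
      simpa using ((hasDerivAt_id t).smul_const s).const_add x
    have hcomp := (hG (x + t • s)).hasFDerivAt.comp_hasDerivAt t hline
    have hlin : HasDerivAt (fun t : ℝ => t • fderiv ℝ G x s) (fderiv ℝ G x s) t := by
      simpa using (hasDerivAt_id t).smul_const (fderiv ℝ G x s)
    exact (hcomp.sub_const (G x)).sub hlin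
  have hB (t : ℝ) : HasDerivAt (fun t : ℝ => 1 / 2 * L * ‖s‖ ^ 2 * t ^ 2)
      (L * ‖s‖ ^ 2 * t) t := by
    refine ((hasDerivAt_pow 2 t).const_mul (1 / 2 * L * ‖s‖ ^ 2)).congr_deriv ?_
    norm_num
    ring
  have h := image_norm_le_of_norm_deriv_right_le_deriv_boundary (a := (0 : ℝ)) (b := 1)
    (fun t _ => (hderiv t).continuousAt.continuousWithinAt)
    (fun t _ => (hderiv t).hasDerivWithinAt) (by simp) hB
    (fun t ht => by
      have hmem : x + t • s ∈ U := hU.add_smul_mem hx hxs ⟨ht.1, ht.2.le⟩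
      calc ‖(fderiv ℝ G (x + t • s) - fderiv ℝ G x) s‖
          ≤ ‖fderiv ℝ G (x + t • s) - fderiv ℝ G x‖ * ‖s‖ := ContinuousLinearMap.le_opNorm _ _
        _ ≤ L * ‖x + t • s - x‖ * ‖s‖ := by gcongr; exact hL _ hmem _ hx
        _ = L * ‖s‖ ^ 2 * t := by
          rw [add_sub_cancel_left, norm_smul, Real.norm_of_nonneg ht.1]
          ring)
    (Set.right_mem_Icc.mpr zero_le_one)
  simpa using h

/-- The gradient of a `C²` function on a Hilbert space is differentiable. -/
theorem ContDiff.differentiable_gradient {E : Type*} [NormedAddCommGroup E]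
    [InnerProductSpace ℝ E] [CompleteSpace E] {f : E → ℝ} (hf : ContDiff ℝ 2 f) :
    Differentiable ℝ (gradient f) := by
  have hdf : Differentiable ℝ (fderiv ℝ f) :=
    (hf.fderiv_right (m := 1) (by norm_num)).differentiable (by norm_num)
  exact (InnerProductSpace.toDual ℝ E).symm.toContinuousLinearEquiv.differentiable.comp hdf

/-- Under Lipschitz continuity of the gradient (constant `g_Lip`) and
of the Hessian (constant `H_Lip`) on an open convex set `U`, if `λ ∈ [0, σ_max‖s‖]` and
the residual `r = ∇f(x) + (∇²f(x) + λI)s` satisfies `‖r‖ ≤ ξ₁‖s‖²` or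
`‖r‖ ≤ ξ₂ min{1,‖s‖}‖∇f(x)‖`, then
`(1 − ξ₂)‖∇f(x+s)‖ ≤ (½H_Lip + σ_max + max{ξ₁, ξ₂g_Lip})‖s‖²`, whence
`‖s‖ ≥ ((1 − ξ₂)/(½H_Lip + σ_max + max{ξ₁, ξ₂g_Lip}))^{1/2} ‖∇f(x+s)‖^{1/2}`. -/
theorem stmt_10 {n : ℕ} (hn : 1 ≤ n)
    (f : EuclideanSpace ℝ (Fin n) → ℝ) (hf : ContDiff ℝ 2 f)
    (U : Set (EuclideanSpace ℝ (Fin n))) (hUopen : IsOpen U) (hUconv : Convex ℝ U)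
    (gLip HLip : ℝ) (hgLip0 : 0 < gLip) (hHLip0 : 0 < HLip)
    (hgLip : ∀ y ∈ U, ∀ z ∈ U, ‖gradient f y - gradient f z‖ ≤ gLip * ‖y - z‖)
    (hHLip : ∀ y ∈ U, ∀ z ∈ U,
      ‖fderiv ℝ (gradient f) y - fderiv ℝ (gradient f) z‖ ≤ HLip * ‖y - z‖)
    (ξ₁ ξ₂ σmax : ℝ) (hξ₁ : 0 < ξ₁) (hξ₂ : ξ₂ ∈ Set.Ioo (0 : ℝ) 1) (hσmax : 0 < σmax)
    (x : EuclideanSpace ℝ (Fin n)) (hx : x ∈ U)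
    (s : EuclideanSpace ℝ (Fin n)) (hxs : x + s ∈ U)
    (lam : ℝ) (hlam : lam ∈ Set.Icc 0 (σmax * ‖s‖))
    (r : EuclideanSpace ℝ (Fin n))
    (hr : r = gradient f x + (fderiv ℝ (gradient f) x) s + lam • s)
    (hres : ‖r‖ ≤ ξ₁ * ‖s‖ ^ 2 ∨ ‖r‖ ≤ ξ₂ * min 1 ‖s‖ * ‖gradient f x‖) :
    (1 - ξ₂) * ‖gradient f (x + s)‖
        ≤ ((1 / 2) * HLip + σmax + max ξ₁ (ξ₂ * gLip)) * ‖s‖ ^ 2 ∧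
    Real.sqrt ((1 - ξ₂) / ((1 / 2) * HLip + σmax + max ξ₁ (ξ₂ * gLip))) *
        Real.sqrt ‖gradient f (x + s)‖ ≤ ‖s‖ := by
  obtain ⟨hξ₂0, hξ₂1⟩ := hξ₂
  have hmain : (1 - ξ₂) * ‖gradient f (x + s)‖
      ≤ ((1 / 2) * HLip + σmax + max ξ₁ (ξ₂ * gLip)) * ‖s‖ ^ 2 := by
    have htaylor := hUconv.norm_image_add_sub_sub_fderiv_le hf.differentiable_gradient hHLip hx hxs
    have hshift : ‖lam • s‖ ≤ σmax * ‖s‖ ^ 2 := by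
      rw [norm_smul, Real.norm_of_nonneg hlam.1]
      calc lam * ‖s‖ ≤ σmax * ‖s‖ * ‖s‖ := by gcongr; exact hlam.2
        _ = σmax * ‖s‖ ^ 2 := by ring
    have hgrad : ‖gradient f (x + s)‖ ≤
        ‖gradient f (x + s) - gradient f x - fderiv ℝ (gradient f) x s‖ + ‖r‖ + ‖lam • s‖ := by
      have hdecomp : gradient f (x + s) =
          (gradient f (x + s) - gradient f x - fderiv ℝ (gradient f) x s) + r - lam • s := by
        rw [hr]
        abel
      calc ‖gradient f (x + s)‖ = _ := congrArg norm hdecomp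
        _ ≤ _ := (norm_sub_le _ _).trans (by gcongr; exact norm_add_le _ _)
    have hr_le : ‖r‖ ≤ max ξ₁ (ξ₂ * gLip) * ‖s‖ ^ 2 + ξ₂ * ‖gradient f (x + s)‖ := by
      rcases hres with h | h
      · have hmax : ξ₁ * ‖s‖ ^ 2 ≤ max ξ₁ (ξ₂ * gLip) * ‖s‖ ^ 2 := by
          gcongr
          exact le_max_left _ _
        have hnonneg : 0 ≤ ξ₂ * ‖gradient f (x + s)‖ := by positivity
        linarith
      · have hLip : ‖gradient f x‖ ≤ ‖gradient f (x + s)‖ + gLip * ‖s‖ := by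
          have hdist := hgLip x hx (x + s) hxs
          rw [sub_add_cancel_left, norm_neg] at hdist
          linarith [norm_sub_norm_le (gradient f x) (gradient f (x + s))]
        have hmin : 0 ≤ min 1 ‖s‖ := le_min zero_le_one (norm_nonneg s)
        calc ‖r‖ ≤ ξ₂ * min 1 ‖s‖ * ‖gradient f x‖ := h
          _ ≤ ξ₂ * min 1 ‖s‖ * (‖gradient f (x + s)‖ + gLip * ‖s‖) := by gcongr
          _ = ξ₂ * gLip * (min 1 ‖s‖ * ‖s‖) + ξ₂ * (min 1 ‖s‖ * ‖gradient f (x + s)‖) := by ring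
          _ ≤ ξ₂ * gLip * (‖s‖ * ‖s‖) + ξ₂ * (1 * ‖gradient f (x + s)‖) := by
            gcongr
            · exact min_le_right _ _
            · exact min_le_left _ _
          _ = ξ₂ * gLip * ‖s‖ ^ 2 + ξ₂ * ‖gradient f (x + s)‖ := by ring
          _ ≤ max ξ₁ (ξ₂ * gLip) * ‖s‖ ^ 2 + ξ₂ * ‖gradient f (x + s)‖ := by
            gcongr
            exact le_max_right _ _
    linarith
  refine ⟨hmain, ?_⟩
  have hC : 0 < (1 / 2) * HLip + σmax + max ξ₁ (ξ₂ * gLip) := by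
    have hmax : 0 < max ξ₁ (ξ₂ * gLip) := lt_max_of_lt_left hξ₁
    positivity
  rw [← Real.sqrt_mul (div_nonneg (sub_nonneg.mpr hξ₂1.le) hC.le)]
  refine Real.sqrt_le_iff.mpr ⟨norm_nonneg s, ?_⟩
  rw [div_mul_eq_mul_div, div_le_iff₀ hC, mul_comm (‖s‖ ^ 2)]
  exact hmain
end

section
/- Let n ≥ 1, let f : ℝⁿ → ℝ be continuously differentiable with f(x) ≥ f_inf for all x ∈ ℝⁿ, and let η > 0 and C > 0. Let {x_k} ⊆ ℝⁿ be a sequence and s_k = x_{k+1} − x_k, and suppose that for all k ∈ ℕ: f(x_k) − f(x_{k+1}) ≥ η‖s_k‖³ and ‖s_k‖ ≥ C^{-1/2} ‖∇f(x_{k+1})‖^{1/2}. Then for every ε ∈ (0,1), the set K(ε) = {k ∈ ℕ : ‖∇f(x_k)‖ > ε} is finite and its cardinality is at most 1 + ⌊(f(x_0) − f_inf) C^{3/2} η⁻¹ ε^{-3/2}⌋. -/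
/-- If every index in a finset comes with a decrease of at least `δ` of an antitone sequence
bounded below by `m`, then `δ` times the number of indices is at most the total decrease. -/
theorem card_mul_le_of_antitone_of_decrease {a : ℕ → ℝ} {m δ : ℝ} (ha : Antitone a)
    (hm : ∀ k, m ≤ a k) (T : Finset ℕ) (hT : ∀ k ∈ T, δ ≤ a k - a (k + 1)) :
    T.card * δ ≤ a 0 - m := by
  obtain ⟨N, hN⟩ := T.exists_nat_subset_range
  calc (T.card : ℝ) * δ = ∑ _k ∈ T, δ := by simp
    _ ≤ ∑ k ∈ T, (a k - a (k + 1)) := Finset.sum_le_sum hT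
    _ ≤ ∑ k ∈ Finset.range N, (a k - a (k + 1)) :=
        Finset.sum_le_sum_of_subset_of_nonneg hN fun k _ _ =>
          sub_nonneg.2 (ha k.le_succ)
    _ = a 0 - a N := Finset.sum_range_sub' a N
    _ ≤ a 0 - m := by linarith [hm N]

/-- An antitone sequence bounded below by `m` decreases by at least `δ > 0` at most
`⌊(a 0 - m) / δ⌋` times. -/
theorem finite_and_ncard_le_of_antitone_of_decrease {a : ℕ → ℝ} {m δ : ℝ} (ha : Antitone a)
    (hm : ∀ k, m ≤ a k) (hδ : 0 < δ) {S : Set ℕ} (hS : ∀ k ∈ S, δ ≤ a k - a (k + 1)) :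
    S.Finite ∧ S.ncard ≤ ⌊(a 0 - m) / δ⌋₊ := by
  have key (T : Finset ℕ) (hT : (T : Set ℕ) ⊆ S) : T.card ≤ ⌊(a 0 - m) / δ⌋₊ :=
    Nat.le_floor <| (le_div_iff₀ hδ).2 <|
      card_mul_le_of_antitone_of_decrease ha hm T fun k hk => hS k (hT hk)
  have hfin : S.Finite := by
    by_contra hinf
    obtain ⟨T, hTS, hT⟩ := Set.Infinite.exists_subset_card_eq hinf (⌊(a 0 - m) / δ⌋₊ + 1)
    have := key T hTS
    lia
  refine ⟨hfin, ?_⟩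
  rw [Set.ncard_eq_toFinset_card S hfin]
  exact key _ (by simp)

/-- A set of naturals has at most one element more than its preimage under the successor. -/
theorem finite_and_ncard_le_of_preimage_succ {S : Set ℕ} (hS : (Nat.succ ⁻¹' S).Finite) :
    S.Finite ∧ S.ncard ≤ 1 + (Nat.succ ⁻¹' S).ncard := by
  have hsub : S ⊆ insert 0 (Nat.succ '' (Nat.succ ⁻¹' S)) := by
    rintro (_ | k) hk
    · exact Set.mem_insert _ _
    · exact Set.mem_insert_of_mem _ ⟨k, hk, rfl⟩
  have hfin := (hS.image Nat.succ).insert 0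
  refine ⟨hfin.subset hsub, (Set.ncard_le_ncard hsub hfin).trans ?_⟩
  refine (Set.ncard_insert_le _ _).trans ?_
  rw [Set.ncard_image_of_injective _ Nat.succ_injective, add_comm]

/-- The cube of the step bound `C ^ (-1/2) * g ^ (1/2) ≤ t` when `ε ≤ g`. -/
theorem rpow_three_halves_mul_le_pow_three {C ε g t : ℝ} (hC : 0 < C) (hε : 0 ≤ ε) (hg : ε ≤ g)
    (ht : C ^ (-(1 : ℝ) / 2) * g ^ ((1 : ℝ) / 2) ≤ t) :
    C ^ (-(3 : ℝ) / 2) * ε ^ ((3 : ℝ) / 2) ≤ t ^ 3 := by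
  calc C ^ (-(3 : ℝ) / 2) * ε ^ ((3 : ℝ) / 2)
      = (C ^ (-(1 : ℝ) / 2) * ε ^ ((1 : ℝ) / 2)) ^ 3 := by
        rw [mul_pow, ← Real.rpow_mul_natCast hC.le, ← Real.rpow_mul_natCast hε]
        norm_num
    _ ≤ t ^ 3 := by
        gcongr
        refine le_trans ?_ ht
        gcongr


/-- If `f` is continuously differentiable and bounded below by `f_inf`,
and the sequence `{x_k}` with steps `s_k = x_{k+1} − x_k` satisfies, for all `k`, the
cubic decrease `f(x_k) − f(x_{k+1}) ≥ η‖s_k‖³` and step-to-gradient bound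
`‖s_k‖ ≥ C^{-1/2}‖∇f(x_{k+1})‖^{1/2}`, then for every `ε ∈ (0,1)` the set
`K(ε) = {k : ‖∇f(x_k)‖ > ε}` is finite with cardinality at most
`1 + ⌊(f(x₀) − f_inf) C^{3/2} η⁻¹ ε^{-3/2}⌋`. -/
theorem stmt_11 {n : ℕ} (hn : 1 ≤ n)
    (f : EuclideanSpace ℝ (Fin n) → ℝ) (hf : ContDiff ℝ 1 f)
    (finf : ℝ) (hbdd : ∀ x, finf ≤ f x)
    (η C : ℝ) (hη : 0 < η) (hC : 0 < C)
    (x s : ℕ → EuclideanSpace ℝ (Fin n))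
    (hs : ∀ k, s k = x (k + 1) - x k)
    (hdec : ∀ k, η * ‖s k‖ ^ 3 ≤ f (x k) - f (x (k + 1)))
    (hstep : ∀ k, C ^ (-(1 : ℝ) / 2) * ‖gradient f (x (k + 1))‖ ^ ((1 : ℝ) / 2) ≤ ‖s k‖)
    (ε : ℝ) (hε : ε ∈ Set.Ioo (0 : ℝ) 1) :
    {k : ℕ | ε < ‖gradient f (x k)‖}.Finite ∧
    Nat.card {k : ℕ | ε < ‖gradient f (x k)‖}
      ≤ 1 + Nat.floor ((f (x 0) - finf) * C ^ ((3 : ℝ) / 2) * η⁻¹ * ε ^ (-(3 : ℝ) / 2)) := by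
  obtain ⟨hε0, -⟩ := hε
  have hanti : Antitone fun k => f (x k) := antitone_nat_of_succ_le fun k => by
    have : 0 ≤ η * ‖s k‖ ^ 3 := by positivity
    linarith [hdec k]
  have hδ : 0 < η * (C ^ (-(3 : ℝ) / 2) * ε ^ ((3 : ℝ) / 2)) := by positivity
  obtain ⟨hfin, hcard⟩ := finite_and_ncard_le_of_antitone_of_decrease hanti
    (fun k => hbdd (x k)) hδ (S := Nat.succ ⁻¹' {k : ℕ | ε < ‖gradient f (x k)‖})
    fun k hk => le_trans (mul_le_mul_of_nonneg_left
      (rpow_three_halves_mul_le_pow_three hC hε0.le (le_of_lt hk) (hstep k)) hη.le) (hdec k)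
  obtain ⟨hfin', hcard'⟩ := finite_and_ncard_le_of_preimage_succ hfin
  refine ⟨hfin', ?_⟩
  rw [Nat.card_coe_set_eq]
  refine hcard'.trans (Nat.add_le_add_left (hcard.trans_eq ?_) 1)
  congr 1
  rw [neg_div, Real.rpow_neg hC.le, Real.rpow_neg hε0.le]
  field_simp
end

section
/- Let n ≥ 1, let f : ℝⁿ → ℝ be continuously differentiable with f(x) ≥ f_inf for all x ∈ ℝⁿ, and let η > 0 and C > 0. Let {x_k} ⊆ ℝⁿ be a sequence and s_k = x_{k+1} − x_k, and suppose that for all k ∈ ℕ: f(x_k) − f(x_{k+1}) ≥ η‖s_k‖³ and ‖s_k‖ ≥ C^{-1/2} ‖∇f(x_{k+1})‖^{1/2}. Then ‖∇f(x_k)‖ → 0 as k → ∞. -/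
open Filter Topology in
/-- A sequence of nonnegative reals whose cubes are dominated, up to a positive factor, by the
decreases of a sequence bounded below tends to zero. -/
theorem tendsto_zero_of_mul_cube_le_sub {a r : ℕ → ℝ} {b η : ℝ} (hη : 0 < η)
    (ha : ∀ k, b ≤ a k) (hr : ∀ k, 0 ≤ r k) (h : ∀ k, η * r k ^ 3 ≤ a k - a (k + 1)) :
    Tendsto r atTop (𝓝 0) := by
  have hanti : Antitone a := antitone_nat_of_succ_le fun k => by
    have := mul_nonneg hη.le (pow_nonneg (hr k) 3)
    linarith [h k]
  have hlim := tendsto_atTop_ciInf hanti ⟨b, by rintro _ ⟨k, rfl⟩; exact ha k⟩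
  have hdiff : Tendsto (fun k => (a k - a (k + 1)) / η) atTop (𝓝 0) := by
    simpa using (hlim.sub (hlim.comp (tendsto_add_atTop_nat 1))).div_const η
  have hcube : Tendsto (fun k => r k ^ 3) atTop (𝓝 0) :=
    squeeze_zero (fun k => pow_nonneg (hr k) 3)
      (fun k => (le_div_iff₀' hη).2 (h k)) hdiff
  have hroot := hcube.rpow_const (p := ((3 : ℕ) : ℝ)⁻¹) (Or.inr (by positivity))
  rw [Real.zero_rpow (by norm_num)] at hroot
  exact hroot.congr fun k => Real.pow_rpow_inv_natCast (hr k) (by norm_num)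

/-- Squaring a lower bound by a scaled square root. -/
theorem le_mul_sq_of_rpow_mul_rpow_le {C g r : ℝ} (hC : 0 < C) (hg : 0 ≤ g)
    (h : C ^ (-(1 : ℝ) / 2) * g ^ ((1 : ℝ) / 2) ≤ r) : g ≤ C * r ^ 2 := by
  have hsq := pow_le_pow_left₀ (by positivity) h 2
  rw [mul_pow, ← Real.rpow_mul_natCast hC.le, ← Real.rpow_mul_natCast hg] at hsq
  norm_num [Real.rpow_neg_one] at hsq
  exact (inv_mul_le_iff₀ hC).1 hsq

/-- If `f` is continuously differentiable and bounded below by `f_inf`,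
and the sequence `{x_k}` with steps `s_k = x_{k+1} − x_k` satisfies, for all `k`, the
cubic decrease `f(x_k) − f(x_{k+1}) ≥ η‖s_k‖³` and step-to-gradient bound
`‖s_k‖ ≥ C^{-1/2}‖∇f(x_{k+1})‖^{1/2}`, then `‖∇f(x_k)‖ → 0` as `k → ∞`. -/
theorem stmt_12 {n : ℕ} (hn : 1 ≤ n)
    (f : EuclideanSpace ℝ (Fin n) → ℝ) (hf : ContDiff ℝ 1 f)
    (finf : ℝ) (hbdd : ∀ x, finf ≤ f x)
    (η C : ℝ) (hη : 0 < η) (hC : 0 < C)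
    (x s : ℕ → EuclideanSpace ℝ (Fin n))
    (hs : ∀ k, s k = x (k + 1) - x k)
    (hdec : ∀ k, η * ‖s k‖ ^ 3 ≤ f (x k) - f (x (k + 1)))
    (hstep : ∀ k, C ^ (-(1 : ℝ) / 2) * ‖gradient f (x (k + 1))‖ ^ ((1 : ℝ) / 2) ≤ ‖s k‖) :
    Filter.Tendsto (fun k => ‖gradient f (x k)‖) Filter.atTop (nhds 0) := by
  have hs_lim : Filter.Tendsto (fun k => ‖s k‖) Filter.atTop (nhds 0) :=
    tendsto_zero_of_mul_cube_le_sub hη (fun k => hbdd (x k)) (fun k => norm_nonneg _) hdec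
  refine (Filter.tendsto_add_atTop_iff_nat 1).1 ?_
  refine squeeze_zero (fun k => norm_nonneg _)
    (fun k => le_mul_sq_of_rpow_mul_rpow_le hC (norm_nonneg _) (hstep k)) ?_
  simpa using (hs_lim.pow 2).const_mul C
end
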